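/- For all α = (α_1,…,α_d) ∈ (0,1)^d and t ∈ ℝ_+^d, the multiparameter fractional GCP distribution has mean Σ_{n=0}^∞ n·p_α(n,t) = Σ_{i=1}^d Σ_{j=1}^k j λ_{ji} t_i^{α_i}/Γ(α_i+1) and variance Σ_{n=0}^∞ n²·p_α(n,t) − (Σ_{n=0}^∞ n·p_α(n,t))² = Σ_{i=1}^d [ Σ_{j=1}^k j² λ_{ji} t_i^{α_i}/Γ(α_i+1) + (Σ_{j=1}^k j λ_{ji} t_i^{α_i})² (2/Γ(2α_i+1) − 1/Γ(α_i+1)²) ]. -/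

import Mathlib

open scoped BigOperators

/-- The three-parameter Mittag-Leffler function
`E^γ_{α,β}(x) = Σ_{r=0}^∞ Γ(r+γ) x^r / (Γ(γ) r! Γ(rα+β))`. -/
noncomputable def ml3 (a b c x : ℝ) : ℝ :=
  ∑' r : ℕ, Real.Gamma (r + c) * x ^ r /
    (Real.Gamma c * (Nat.factorial r) * Real.Gamma (r * a + b))

/-- The distribution of the multiparameter fractional GCP:
`p_α(n,t) = Σ_{(n_1,…,n_k) ∈ Ω(k,n)} Σ_{(n_{j1},…,n_{jd}) ∈ Θ(n_j,d), j = 1,…,k}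
  ∏_i (Σ_j n_{ji})! (∏_j (λ_{ji} t_i^{α_i})^{n_{ji}}/n_{ji}!)
       E^{Σ_j n_{ji}+1}_{α_i, α_i Σ_j n_{ji}+1}(−t_i^{α_i} Σ_j λ_{ji})`. -/
noncomputable def pFrac (d k : ℕ) (lam : Fin k → Fin d → ℝ) (alpha : Fin d → ℝ)
    (n : ℕ) (t : Fin d → ℝ) : ℝ :=
  ∑' y : Fin k → ℕ,
    if (∑ j, (j.1 + 1) * y j) = n then
      ∑' m : Fin k → Fin d → ℕ,
        if (∀ j, (∑ i, m j i) = y j) then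
          ∏ i, ((Nat.factorial (∑ j, m j i) : ℝ) *
            (∏ j, (lam j i * t i ^ alpha i) ^ (m j i) / (Nat.factorial (m j i))) *
            ml3 (alpha i) (alpha i * (∑ j, m j i) + 1) ((∑ j, m j i) + 1)
              (-(t i ^ alpha i) * ∑ j, lam j i))
        else 0
    else 0

section FiberwiseSums

variable {β γ : Type*}

theorem HasSum.tsum_ite_fiber [DecidableEq γ] {f : β → ℝ} {a : ℝ} (hf : HasSum f a)
    (g : β → γ) : HasSum (fun c => ∑' b, if g b = c then f b else 0) a := by
  have h := hf.tsum_fiberwise g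
  have hfun : (fun c => ∑' b, if g b = c then f b else 0) = fun c => ∑' b : g ⁻¹' {c}, f b := by
    ext c
    rw [tsum_subtype (g ⁻¹' {c}) f]
    refine tsum_congr fun b => ?_
    by_cases hb : g b = c
    · rw [if_pos hb, Set.indicator_of_mem (show b ∈ g ⁻¹' {c} from hb)]
    · rw [if_neg hb, Set.indicator_of_notMem (show b ∉ g ⁻¹' {c} from hb)]
  rwa [hfun]

/-- A nonnegative function is summable as soon as its sums over the fibers of a map with finite
fibers are. -/
theorem summable_of_summable_fiber_sum {f : β → ℝ} (hf : 0 ≤ f) (g : β → γ) (s : γ → Finset β)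
    (hs : ∀ c b, b ∈ s c ↔ g b = c) (h : Summable fun c => ∑ b ∈ s c, f b) : Summable f := by
  have hfin (c : γ) : HasSum (fun x : {b // g b = c} => f x) (∑ b ∈ s c, f b) :=
    (Equiv.subtypeEquivRight (hs c)).hasSum_iff.1 ((s c).hasSum f)
  rw [← (Equiv.sigmaFiberEquiv g).summable_iff]
  refine (summable_sigma_of_nonneg fun x => hf _).2 ⟨fun c => (hfin c).summable, ?_⟩
  exact h.congr fun c => (hfin c).tsum_eq.symm

theorem hasSum_fiber_sum [DecidableEq γ] {f : β → ℝ} {a : ℝ} (hf : HasSum f a) (g : β → γ)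
    (s : γ → Finset β) (hs : ∀ c b, b ∈ s c ↔ g b = c) : HasSum (fun c => ∑ b ∈ s c, f b) a := by
  convert hf.tsum_ite_fiber g using 2 with c
  rw [tsum_eq_sum (s := s c) fun b hb => if_neg (mt (hs c b).2 hb)]
  exact Finset.sum_congr rfl fun b hb => (if_pos ((hs c b).1 hb)).symm

end FiberwiseSums

section MittagLeffler

theorem eventually_rpow_div_le_Gamma {a R : ℝ} (ha : 0 < a) (hR : 1 ≤ R) :
    ∀ᶠ n : ℕ in Filter.atTop, R ^ (a * n) / R ≤ Real.Gamma (n * a + 1) := by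
  have hlim : Filter.Tendsto (fun n : ℕ => (n : ℝ) * a) Filter.atTop Filter.atTop :=
    tendsto_natCast_atTop_atTop.atTop_mul_const ha
  have hfloor := tendsto_nat_floor_atTop.comp hlim
  have h1 := (FloorSemiring.tendsto_pow_div_factorial_atTop R).eventually_lt_const one_pos
  filter_upwards [hfloor.eventually h1, hlim.eventually_ge_atTop 1] with n hn hn1
  simp only [Function.comp_apply] at hn
  set y : ℝ := n * a
  have hR0 : 0 < R := by positivity
  have hfl : 1 ≤ ⌊y⌋₊ := Nat.le_floor (by simpa using hn1)
  have hfl' : (1 : ℝ) ≤ ⌊y⌋₊ := by exact_mod_cast hfl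
  calc R ^ (a * n) / R = R ^ (y - 1) := by
        rw [Real.rpow_sub hR0, Real.rpow_one, mul_comm a]
    _ ≤ R ^ ((⌊y⌋₊ : ℝ)) :=
        Real.rpow_le_rpow_of_exponent_le hR (by linarith [Nat.lt_floor_add_one y])
    _ = R ^ ⌊y⌋₊ := Real.rpow_natCast _ _
    _ ≤ (Nat.factorial ⌊y⌋₊ : ℝ) := by
        rw [div_lt_one (by positivity)] at hn
        exact hn.le
    _ = Real.Gamma (⌊y⌋₊ + 1) := (Real.Gamma_nat_eq_factorial _).symm
    _ ≤ Real.Gamma (y + 1) :=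
        Real.Gamma_strictMonoOn_Ici.monotoneOn (by simp only [Set.mem_Ici]; linarith)
          (by simp only [Set.mem_Ici]; linarith)
          (by linarith [Nat.floor_le (show 0 ≤ y by linarith)])

/-- The one-parameter Mittag-Leffler series converges everywhere. -/
theorem summable_pow_div_Gamma {a : ℝ} (ha : 0 < a) (x : ℝ) :
    Summable fun n : ℕ => x ^ n * (1 / Real.Gamma (n * a + 1)) := by
  set y : ℝ := 2 * |x| + 1
  have hy : 1 ≤ y := by simp only [y]; linarith [abs_nonneg x]
  have hy0 : 0 < y := by linarith
  set R : ℝ := y ^ (1 / a)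
  have hR : 1 ≤ R := Real.one_le_rpow hy (by positivity)
  have hR0 : 0 < R := by linarith
  have hgeom : Summable fun n : ℕ => R * (1 / 2 : ℝ) ^ n :=
    (summable_geometric_of_lt_one (by norm_num) (by norm_num)).mul_left R
  refine summable_of_isBigO_nat hgeom (Asymptotics.IsBigO.of_bound 1 ?_)
  filter_upwards [eventually_rpow_div_le_Gamma ha hR] with n hn
  have hRn : R ^ (a * n) = y ^ n := by
    rw [← Real.rpow_mul hy0.le, ← Real.rpow_natCast]
    congr 1
    field_simp
  rw [hRn] at hn
  have hxy : |x| / y ≤ 1 / 2 := by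
    rw [div_le_div_iff₀ hy0 two_pos]
    simp only [y]
    linarith
  have hG : 0 < Real.Gamma (n * a + 1) := Real.Gamma_pos_of_pos (by positivity)
  rw [Real.norm_eq_abs, Real.norm_eq_abs, abs_mul, abs_pow, abs_of_pos (one_div_pos.2 hG),
    one_mul, abs_of_pos (show 0 < R * (1 / 2) ^ n by positivity)]
  calc |x| ^ n * (1 / Real.Gamma (n * a + 1)) ≤ |x| ^ n * (1 / (y ^ n / R)) := by gcongr
    _ = R * (|x| / y) ^ n := by rw [div_pow]; field_simp
    _ ≤ R * (1 / 2) ^ n := by gcongr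

end MittagLeffler

section MultinomialMoments

variable {ι : Type*} [Fintype ι]

/-- The term indexed by `e` in the multinomial expansion of a power of `∑ o, b o`. -/
noncomputable def multinomialTerm (b : ι → ℝ) (e : ι → ℕ) : ℝ :=
  (Nat.factorial (∑ o, e o) : ℝ) * ∏ o, b o ^ e o / (Nat.factorial (e o))

theorem sum_multinomialTerm [DecidableEq ι] (b : ι → ℝ) (N : ℕ) :
    ∑ e ∈ Finset.univ.piAntidiag N, multinomialTerm b e = (∑ o, b o) ^ N := by
  rw [Finset.sum_pow_eq_sum_piAntidiag]
  refine Finset.sum_congr rfl fun e _ => ?_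
  rw [multinomialTerm, ← Nat.multinomial_spec, Finset.prod_div_distrib]
  push_cast
  field_simp [Finset.prod_ne_zero_iff, Nat.factorial_ne_zero]

theorem multinomialTerm_mul_exp (b u : ι → ℝ) (s : ℝ) (e : ι → ℕ) :
    multinomialTerm (fun o => b o * Real.exp (s * u o)) e =
      multinomialTerm b e * Real.exp (s * ∑ o, u o * e o) := by
  simp only [multinomialTerm, mul_pow, Finset.mul_sum, Real.exp_sum, mul_assoc,
    ← Finset.prod_mul_distrib]
  congr 1
  refine Finset.prod_congr rfl fun o _ => ?_
  rw [← Real.exp_nat_mul]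
  ring_nf

theorem hasDerivAt_sum_mul_exp {κ : Type*} (t : Finset κ) (f w : κ → ℝ) (s : ℝ) :
    HasDerivAt (fun s => ∑ e ∈ t, f e * Real.exp (s * w e))
      (∑ e ∈ t, f e * w e * Real.exp (s * w e)) s := by
  refine (HasDerivAt.fun_sum fun e _ =>
    (((hasDerivAt_id s).mul_const (w e)).exp.const_mul (f e))).congr_deriv ?_
  refine Finset.sum_congr rfl fun e _ => ?_
  simp only [id]
  ring

theorem sum_multinomialTerm_mul_exp [DecidableEq ι] (b u : ι → ℝ) (N : ℕ) (s : ℝ) :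
    ∑ e ∈ Finset.univ.piAntidiag N, multinomialTerm b e * Real.exp (s * ∑ o, u o * e o) =
      (∑ o, b o * Real.exp (s * u o)) ^ N := by
  simp only [← multinomialTerm_mul_exp, sum_multinomialTerm]

theorem sum_multinomialTerm_mul_linear_mul_exp [DecidableEq ι] (b u : ι → ℝ) (N : ℕ) (s : ℝ) :
    ∑ e ∈ Finset.univ.piAntidiag N,
        multinomialTerm b e * (∑ o, u o * e o) * Real.exp (s * ∑ o, u o * e o) =
      N * (∑ o, b o * Real.exp (s * u o)) ^ (N - 1) * ∑ o, b o * u o * Real.exp (s * u o) := by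
  have h1 := hasDerivAt_sum_mul_exp (Finset.univ.piAntidiag N) (multinomialTerm b)
    (fun e => ∑ o, u o * (e o : ℝ)) s
  simp only [sum_multinomialTerm_mul_exp] at h1
  exact h1.unique ((hasDerivAt_sum_mul_exp Finset.univ b u s).pow N)

theorem sum_linear_mul_multinomialTerm [DecidableEq ι] (b u : ι → ℝ) (N : ℕ) :
    ∑ e ∈ Finset.univ.piAntidiag N, (∑ o, u o * e o) * multinomialTerm b e =
      N * (∑ o, b o) ^ (N - 1) * ∑ o, b o * u o := by
  simpa [mul_comm] using sum_multinomialTerm_mul_linear_mul_exp b u N 0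

theorem sum_linear_sq_mul_multinomialTerm [DecidableEq ι] (b u : ι → ℝ) (N : ℕ) :
    ∑ e ∈ Finset.univ.piAntidiag N, (∑ o, u o * e o) ^ 2 * multinomialTerm b e =
      N * ((N - 1 : ℕ) * (∑ o, b o) ^ (N - 1 - 1) * (∑ o, b o * u o) ^ 2 +
        (∑ o, b o) ^ (N - 1) * ∑ o, b o * u o ^ 2) := by
  have h1 := hasDerivAt_sum_mul_exp (Finset.univ.piAntidiag N)
    (fun e => multinomialTerm b e * ∑ o, u o * (e o : ℝ)) (fun e => ∑ o, u o * (e o : ℝ)) 0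
  simp only [sum_multinomialTerm_mul_linear_mul_exp] at h1
  have h2 := h1.unique ((((hasDerivAt_sum_mul_exp Finset.univ b u 0).fun_pow (N - 1)).const_mul
    (N : ℝ)).fun_mul (hasDerivAt_sum_mul_exp Finset.univ (fun o => b o * u o) u 0))
  simp only [zero_mul, Real.exp_zero, mul_one] at h2
  calc _ = ∑ e ∈ Finset.univ.piAntidiag N,
        multinomialTerm b e * (∑ o, u o * (e o : ℝ)) * ∑ o, u o * (e o : ℝ) :=
          Finset.sum_congr rfl fun e _ => by ring
    _ = _ := by
      rw [h2]
      simp only [mul_assoc, ← sq]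
      ring

theorem summable_linear_pow_mul_multinomialTerm {c : ℕ → ℝ} (hc : 0 ≤ c)
    (hsum : ∀ x : ℝ, Summable fun N => x ^ N * c N) (b : ι → ℝ) {u : ι → ℝ} (hu : 0 ≤ u) (p : ℕ) :
    Summable fun e : ι → ℕ => (∑ o, u o * e o) ^ p * (multinomialTerm b e * c (∑ o, e o)) := by
  classical
  have hmaj : Summable fun e : ι → ℕ => (Nat.factorial p : ℝ) *
      (multinomialTerm (fun o => |b o| * Real.exp (1 * u o)) e * c (∑ o, e o)) := by
    refine Summable.mul_left _ (summable_of_summable_fiber_sum ?_ (fun e => ∑ o, e o)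
      (fun N => Finset.univ.piAntidiag N) (by simp) ?_)
    · intro e
      have := hc (∑ o, e o)
      simp only [multinomialTerm, Pi.zero_apply] at this ⊢
      positivity
    · refine (hsum (∑ o, |b o| * Real.exp (1 * u o))).congr fun N => ?_
      rw [← sum_multinomialTerm, Finset.sum_mul]
      refine Finset.sum_congr rfl fun e he => ?_
      rw [(Finset.mem_piAntidiag.1 he).1]
  refine Summable.of_norm_bounded hmaj fun e => ?_
  have hw : 0 ≤ ∑ o, u o * (e o : ℝ) :=
    Finset.sum_nonneg fun o _ => mul_nonneg (hu o) (Nat.cast_nonneg _)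
  have habs : |multinomialTerm b e| = multinomialTerm (fun o => |b o|) e := by
    simp [multinomialTerm, abs_mul, Finset.abs_prod, abs_div]
  have hpow := Real.pow_div_factorial_le_exp _ hw p
  rw [div_le_iff₀ (by positivity)] at hpow
  have hcN := hc (∑ o, e o)
  rw [Real.norm_eq_abs, abs_mul, abs_mul, habs, abs_of_nonneg hcN, abs_of_nonneg (by positivity),
    multinomialTerm_mul_exp, one_mul]
  have hm : 0 ≤ multinomialTerm (fun o => |b o|) e := habs ▸ abs_nonneg _
  calc _ ≤ _ := mul_le_mul_of_nonneg_right hpow (mul_nonneg hm hcN)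
    _ = _ := by ring

theorem hasSum_linear_pow_mul_multinomialTerm [DecidableEq ι] {c : ℕ → ℝ} (hc : 0 ≤ c)
    (hsum : ∀ x : ℝ, Summable fun N => x ^ N * c N) (b : ι → ℝ) {u : ι → ℝ} (hu : 0 ≤ u)
    (p : ℕ) {a : ℝ}
    (ha : HasSum (fun N : ℕ => (∑ e ∈ Finset.univ.piAntidiag N,
      (∑ o, u o * (e o : ℝ)) ^ p * multinomialTerm b e) * c N) a) :
    HasSum (fun e : ι → ℕ => (∑ o, u o * e o) ^ p * (multinomialTerm b e * c (∑ o, e o))) a := by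
  have h := (summable_linear_pow_mul_multinomialTerm hc hsum b hu p).hasSum
  convert h
  refine ha.unique ?_
  convert hasSum_fiber_sum h (fun e => ∑ o, e o) (fun N => Finset.univ.piAntidiag N)
    (by simp) using 2 with N
  rw [Finset.sum_mul]
  refine Finset.sum_congr rfl fun e he => ?_
  rw [(Finset.mem_piAntidiag.1 he).1, mul_assoc]

end MultinomialMoments

section ComponentLaw

variable {κ : Type*} [Fintype κ]

/-- The factor of the multiparameter law contributed by a single time parameter: `a` collects the
products of rates and powers of time, `x` is the argument of the Mittag-Leffler function. -/
noncomputable def componentLaw (alpha : ℝ) (a : κ → ℝ) (x : ℝ) (m : κ → ℕ) : ℝ :=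
  (Nat.factorial (∑ j, m j) : ℝ) * (∏ j, a j ^ m j / (Nat.factorial (m j))) *
    ml3 alpha (alpha * (∑ j, m j) + 1) ((∑ j, m j) + 1) x

theorem componentLaw_eq_tsum (alpha : ℝ) (a : κ → ℝ) (x : ℝ) (m : κ → ℕ) :
    componentLaw alpha a x m = ∑' r : ℕ,
      multinomialTerm (fun o : Option κ => o.elim x a) (fun o : Option κ => o.elim r m) *
        (1 / Real.Gamma ((∑ o : Option κ, o.elim r m : ℕ) * alpha + 1)) := by
  rw [componentLaw, ml3, ← tsum_mul_left]
  refine tsum_congr fun r => ?_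
  simp only [multinomialTerm, Fintype.sum_option, Fintype.prod_option, Option.elim_none,
    Option.elim_some]
  have h2 : (r : ℝ) + ((∑ j, m j : ℕ) + 1) = ((r + ∑ j, m j : ℕ) : ℝ) + 1 := by push_cast; ring
  have h3 : (r : ℝ) * alpha + (alpha * (∑ j, m j : ℕ) + 1) =
      ((r + ∑ j, m j : ℕ) : ℝ) * alpha + 1 := by push_cast; ring
  rw [h2, h3, Real.Gamma_nat_eq_factorial, Real.Gamma_nat_eq_factorial]
  have h4 : ((∑ j, m j).factorial : ℝ) ≠ 0 := by positivity
  have h5 : (r.factorial : ℝ) ≠ 0 := by positivity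
  field_simp

theorem hasSum_linear_pow_mul_componentLaw [DecidableEq κ] {alpha : ℝ} (halpha : 0 < alpha) (a : κ → ℝ) (x : ℝ)
    {u : κ → ℝ} (hu : 0 ≤ u) (p : ℕ) {v : ℝ}
    (hv : HasSum (fun N : ℕ => (∑ e ∈ Finset.univ.piAntidiag N,
      (∑ o : Option κ, o.elim 0 u * (e o : ℝ)) ^ p *
        multinomialTerm (fun o : Option κ => o.elim x a) e) *
        (1 / Real.Gamma (N * alpha + 1))) v) :
    HasSum (fun m : κ → ℕ => (∑ j, u j * m j) ^ p * componentLaw alpha a x m) v := by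
  have hc : (0 : ℕ → ℝ) ≤ fun N : ℕ => 1 / Real.Gamma (N * alpha + 1) := fun N =>
    one_div_nonneg.2 (Real.Gamma_nonneg_of_nonneg (by positivity))
  have hu' : (0 : Option κ → ℝ) ≤ fun o => o.elim 0 u := by
    rintro (_ | j)
    exacts [le_rfl, hu j]
  have h := hasSum_linear_pow_mul_multinomialTerm hc (summable_pow_div_Gamma halpha)
    (fun o : Option κ => o.elim x a) hu' p hv
  let E : (κ → ℕ) × ℕ ≃ (Option κ → ℕ) :=
    (Equiv.prodComm _ _).trans (Equiv.piOptionEquivProd (β := fun _ : Option κ => ℕ)).symm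
  have hE (m : κ → ℕ) (r : ℕ) : E (m, r) = fun o => o.elim r m := by
    ext o
    cases o <;> rfl
  rw [← E.hasSum_iff] at h
  refine h.prod_fiberwise fun m => ?_
  have hm := (h.summable.prod_factor m).hasSum
  simpa only [Function.comp_apply, hE, componentLaw_eq_tsum, Fintype.sum_option,
    Option.elim_none, Option.elim_some,
    zero_mul, zero_add, tsum_mul_left] using hm

theorem hasSum_componentLaw {alpha : ℝ} (halpha : 0 < alpha) {a : κ → ℝ} {x : ℝ}
    (hx : x + ∑ j, a j = 0) :
    HasSum (componentLaw alpha a x) 1 := by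
  classical
  have h := hasSum_linear_pow_mul_componentLaw halpha a x (u := 0) le_rfl 0 (v := 1) ?_
  · simpa using h
  · simp only [pow_zero, one_mul, sum_multinomialTerm, Fintype.sum_option,
      Option.elim_none, Option.elim_some, hx]
    convert hasSum_single 0 fun N hN => ?_ using 1
    · simp
    · simp [hN]

theorem hasSum_linear_mul_componentLaw {alpha : ℝ} (halpha : 0 < alpha) {a : κ → ℝ} {x : ℝ}
    (hx : x + ∑ j, a j = 0) {u : κ → ℝ} (hu : 0 ≤ u) :
    HasSum (fun m : κ → ℕ => (∑ j, u j * m j) * componentLaw alpha a x m)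
      ((∑ j, u j * a j) / Real.Gamma (alpha + 1)) := by
  classical
  have h := hasSum_linear_pow_mul_componentLaw halpha a x hu 1
    (v := (∑ j, u j * a j) / Real.Gamma (alpha + 1)) ?_
  · simpa only [pow_one] using h
  · simp only [pow_one, sum_linear_mul_multinomialTerm]
    simp only [Fintype.sum_option, Option.elim_none, Option.elim_some, hx]
    convert hasSum_single 1 fun N hN => ?_ using 1
    · simp [mul_comm, div_eq_mul_inv]
    · rcases N with _ | N
      · simp
      · simp [show N ≠ 0 by omega]

theorem hasSum_linear_sq_mul_componentLaw {alpha : ℝ} (halpha : 0 < alpha) {a : κ → ℝ} {x : ℝ}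
    (hx : x + ∑ j, a j = 0) {u : κ → ℝ} (hu : 0 ≤ u) :
    HasSum (fun m : κ → ℕ => (∑ j, u j * m j) ^ 2 * componentLaw alpha a x m)
      ((∑ j, u j ^ 2 * a j) / Real.Gamma (alpha + 1) +
        2 * (∑ j, u j * a j) ^ 2 / Real.Gamma (2 * alpha + 1)) := by
  classical
  refine hasSum_linear_pow_mul_componentLaw halpha a x hu 2 ?_
  simp only [sum_linear_sq_mul_multinomialTerm]
  simp only [Fintype.sum_option, Option.elim_none, Option.elim_some, hx]
  convert hasSum_sum_of_ne_finset_zero (s := {1, 2}) (L := .unconditional ℕ) fun N hN => ?_ using 1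
  · rw [Finset.sum_pair (by norm_num)]
    simp [mul_comm, div_eq_mul_inv]
  · rcases N with _ | _ | _ | N <;> simp at hN ⊢

end ComponentLaw

section IndependentSums

variable {β : Type*}

/-- The first two moments of a sum of independent variables with (possibly signed) laws of total
mass one. -/
theorem hasSum_prod_moments (d : ℕ) (q : Fin d → β → ℝ) (w : β → ℝ) (s₁ s₂ : Fin d → ℝ)
    (h₀ : ∀ i, HasSum (q i) 1) (h₁ : ∀ i, HasSum (fun y => w y * q i y) (s₁ i))
    (h₂ : ∀ i, HasSum (fun y => w y ^ 2 * q i y) (s₂ i)) :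
    HasSum (fun y : Fin d → β => ∏ i, q i (y i)) 1 ∧
    HasSum (fun y : Fin d → β => (∑ i, w (y i)) * ∏ i, q i (y i)) (∑ i, s₁ i) ∧
    HasSum (fun y : Fin d → β => (∑ i, w (y i)) ^ 2 * ∏ i, q i (y i))
      (∑ i, (s₂ i - s₁ i ^ 2) + (∑ i, s₁ i) ^ 2) := by
  induction d with
  | zero =>
    refine ⟨?_, ?_, ?_⟩
    · simp
    all_goals simp
  | succ d ih =>
    obtain ⟨g₀, g₁, g₂⟩ := ih (fun i => q i.succ) (fun i => s₁ i.succ) (fun i => s₂ i.succ)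
      (fun i => h₀ _) (fun i => h₁ _) (fun i => h₂ _)
    have hmul {f : β → ℝ} {g : (Fin d → β) → ℝ} {a b : ℝ} (hf : HasSum f a) (hg : HasSum g b) :
        HasSum (fun z : β × (Fin d → β) => f z.1 * g z.2) (a * b) :=
      hf.mul hg (summable_mul_of_summable_norm hf.summable.norm hg.summable.norm)
    refine ⟨?_, ?_, ?_⟩ <;> rw [← (Fin.consEquiv fun _ => β).hasSum_iff]
    · convert hmul (h₀ 0) g₀ using 1
      · ext z
        simp [Fin.consEquiv, Fin.prod_univ_succ]
      · simp
    · convert (hmul (h₁ 0) g₀).add (hmul (h₀ 0) g₁) using 1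
      · ext z
        simp only [Function.comp_apply, Fin.consEquiv_apply, Fin.prod_univ_succ,
          Fin.sum_univ_succ, Fin.cons_zero, Fin.cons_succ]
        ring
      · rw [Fin.sum_univ_succ]
        ring
    · convert ((hmul (h₂ 0) g₀).add ((hmul (h₁ 0) g₁).mul_left 2)).add (hmul (h₀ 0) g₂) using 1
      · ext z
        simp only [Function.comp_apply, Fin.consEquiv_apply, Fin.prod_univ_succ,
          Fin.sum_univ_succ, Fin.cons_zero, Fin.cons_succ]
        ring
      · rw [Fin.sum_univ_succ, Fin.sum_univ_succ]
        ring

end IndependentSums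

theorem hasSum_pow_mul_pFrac {d k : ℕ} {lam : Fin k → Fin d → ℝ} {alpha t : Fin d → ℝ} (p : ℕ)
    {v : ℝ} (hv : HasSum (fun y : Fin d → Fin k → ℕ =>
      (∑ i, ∑ j : Fin k, (j.1 + 1 : ℝ) * y i j) ^ p *
        ∏ i, componentLaw (alpha i) (fun j => lam j i * t i ^ alpha i)
          (-(t i ^ alpha i) * ∑ j, lam j i) (y i)) v) :
    HasSum (fun n : ℕ => (n : ℝ) ^ p * pFrac d k lam alpha n t) v := by
  have h := (Equiv.piComm fun (_ : Fin k) (_ : Fin d) => ℕ).hasSum_iff.2 hv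
  have h' := (h.tsum_ite_fiber fun m j => ∑ i, m j i).tsum_ite_fiber
    fun y : Fin k → ℕ => ∑ j, (j.1 + 1) * y j
  convert h' using 2 with n
  rw [pFrac, ← tsum_mul_left]
  refine tsum_congr fun y => ?_
  split_ifs with hy
  · rw [← tsum_mul_left]
    refine tsum_congr fun m => ?_
    by_cases hm : ∀ j, ∑ i, m j i = y j
    · rw [if_pos hm, if_pos (funext hm)]
      have hn : (n : ℝ) = ∑ i, ∑ j : Fin k, (j.1 + 1 : ℝ) * m j i := by
        rw [← hy, Finset.sum_comm]
        push_cast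
        refine Finset.sum_congr rfl fun j _ => ?_
        rw [← hm j, ← Finset.mul_sum]
        push_cast
        rfl
      rw [hn]
      rfl
    · rw [if_neg hm, if_neg (mt congrFun hm), mul_zero]
  · rw [mul_zero]

/-- For all `α ∈ (0,1)^d` and `t ∈ ℝ_+^d`, the multiparameter fractional GCP distribution
has mean `Σ_n n·p_α(n,t) = Σ_i Σ_j j λ_{ji} t_i^{α_i}/Γ(α_i+1)` and variance
`Σ_n n²·p_α(n,t) − (Σ_n n·p_α(n,t))²
  = Σ_i [Σ_j j² λ_{ji} t_i^{α_i}/Γ(α_i+1)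
     + (Σ_j j λ_{ji} t_i^{α_i})² (2/Γ(2α_i+1) − 1/Γ(α_i+1)²)]`. -/
theorem pFrac_mean_variance (d k : ℕ) (hd : 1 ≤ d) (hk : 1 ≤ k)
    (lam : Fin k → Fin d → ℝ) (hlam : ∀ j i, 0 < lam j i)
    (alpha : Fin d → ℝ) (halpha : ∀ i, alpha i ∈ Set.Ioo (0 : ℝ) 1)
    (t : Fin d → ℝ) (ht : ∀ i, 0 ≤ t i) :
    (∑' n : ℕ, (n : ℝ) * pFrac d k lam alpha n t
        = ∑ i, ∑ j : Fin k, (j.1 + 1 : ℝ) * lam j i * t i ^ alpha i /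
            Real.Gamma (alpha i + 1)) ∧
    (∑' n : ℕ, (n : ℝ) ^ 2 * pFrac d k lam alpha n t
        - (∑' n : ℕ, (n : ℝ) * pFrac d k lam alpha n t) ^ 2
      = ∑ i,
          ((∑ j : Fin k, (j.1 + 1 : ℝ) ^ 2 * lam j i * t i ^ alpha i /
              Real.Gamma (alpha i + 1)) +
            (∑ j : Fin k, (j.1 + 1 : ℝ) * lam j i * t i ^ alpha i) ^ 2 *
              (2 / Real.Gamma (2 * alpha i + 1) - 1 / Real.Gamma (alpha i + 1) ^ 2))) := by
  have hu : (0 : Fin k → ℝ) ≤ fun j => (j.1 + 1 : ℝ) := fun j => by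
    simp only [Pi.zero_apply]
    positivity
  have hx (i : Fin d) :
      -(t i ^ alpha i) * ∑ j, lam j i + ∑ j, lam j i * t i ^ alpha i = 0 := by
    rw [← Finset.sum_mul]
    ring
  obtain ⟨-, hm₁, hm₂⟩ := hasSum_prod_moments d _ _ _ _
    (fun i => hasSum_componentLaw (halpha i).1 (hx i))
    (fun i => hasSum_linear_mul_componentLaw (halpha i).1 (hx i) hu)
    (fun i => hasSum_linear_sq_mul_componentLaw (halpha i).1 (hx i) hu)
  have hmean := hasSum_pow_mul_pFrac 1 (by simpa only [pow_one] using hm₁)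
  simp only [pow_one] at hmean
  rw [hmean.tsum_eq, (hasSum_pow_mul_pFrac 2 hm₂).tsum_eq, add_sub_cancel_right]
  simp only [← Finset.sum_div, mul_assoc, true_and]
  refine Finset.sum_congr rfl fun i _ => ?_
  rw [div_pow]
  ring
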